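/- Let {Π_{ik}} be an α-unitary measurement design on ℂ^q with α > 0, let ρ be a density matrix, and let p_{ik} be the empirical frequencies from r independent shots per observable. Then the least-squares estimator (the unique minimizer of Loss[S] = Σ_{i,k}(tr(SΠ_{ik}) − p_{ik})²/m_{ik} over trace-1 Hermitian matrices) equals ρ̂ = (1/(nα)) Σ_{i=1}^n Σ_{k=1}^{q_i} (p_{ik}/m_{ik}) Π_{ik} − ((1−α)/α)(I_q/q). If moreover every projection has rank one (m_{ik} = 1 for all i,k, so q_i = q and α = 1/(q+1)), then the mean-squared error satisfies E[‖ρ̂ − ρ‖₂²] = (1/(n r α²)) [ (1 − 1/q) − α (tr(ρ²) − 1/q) ]. -/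

import Mathlib

open Matrix Finset
open scoped ComplexOrder

noncomputable section

/-- The Gram superoperator `G[S] = (1/n) Σ_i Σ_k (tr(S Π_{ik})/m_{ik}) Π_{ik}`. -/
def gramOf {q n : ℕ} (out : Fin n → ℕ)
    (P : (i : Fin n) → Fin (out i) → Matrix (Fin q) (Fin q) ℂ)
    (S : Matrix (Fin q) (Fin q) ℂ) : Matrix (Fin q) (Fin q) ℂ :=
  (n : ℂ)⁻¹ • ∑ i, ∑ k, ((S * P i k).trace / (P i k).trace) • P i k

/-- The squared Frobenius (Hilbert–Schmidt) norm of a complex matrix. -/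
def frobSq {q : ℕ} (M : Matrix (Fin q) (Fin q) ℂ) : ℝ :=
  ∑ a, ∑ b, Complex.normSq (M a b)

/-- Empirical frequency of outcome `k` for observable `i` among `r` shots `ω i`. -/
def empFreq {n r : ℕ} {out : Fin n → ℕ}
    (ω : (i : Fin n) → Fin r → Fin (out i)) (i : Fin n) (k : Fin (out i)) : ℝ :=
  ((Finset.univ.filter (fun j : Fin r => ω i j = k)).card : ℝ) / r

/-- Probability of the sample `ω` under the Born rule for the state `ρ` (i.i.d. shots). -/
def bornProb {q n r : ℕ} {out : Fin n → ℕ}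
    (P : (i : Fin n) → Fin (out i) → Matrix (Fin q) (Fin q) ℂ)
    (ρ : Matrix (Fin q) (Fin q) ℂ)
    (ω : (i : Fin n) → Fin r → Fin (out i)) : ℝ :=
  ∏ i, ∏ j, ((ρ * P i (ω i j)).trace).re

/-- The least-squares loss with data `p`. -/
def lossOf {q n : ℕ} (out : Fin n → ℕ)
    (P : (i : Fin n) → Fin (out i) → Matrix (Fin q) (Fin q) ℂ)
    (p : (i : Fin n) → Fin (out i) → ℝ)
    (S : Matrix (Fin q) (Fin q) ℂ) : ℝ :=
  ∑ i, ∑ k, ((S * P i k).trace.re - p i k) ^ 2 / (P i k).trace.re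

/-- The closed-form least-squares estimator under an `α`-unitary design:
`ρ̂ = (1/(nα)) Σ_{i,k} (p_{ik}/m_{ik}) Π_{ik} − ((1−α)/α)(I_q/q)`. -/
def lseOf {q n : ℕ} (out : Fin n → ℕ)
    (P : (i : Fin n) → Fin (out i) → Matrix (Fin q) (Fin q) ℂ)
    (α : ℝ) (p : (i : Fin n) → Fin (out i) → ℝ) : Matrix (Fin q) (Fin q) ℂ :=
  ((n : ℂ) * (α : ℂ))⁻¹ • ∑ i, ∑ k, ((p i k : ℂ) / (P i k).trace) • P i k
    - (((1 : ℂ) - (α : ℂ)) / (α : ℂ)) • ((q : ℂ)⁻¹ • (1 : Matrix (Fin q) (Fin q) ℂ))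

section ProductWeights

variable {ι : Type*} [Fintype ι] [DecidableEq ι] {Ω : ι → Type*} [∀ i, Fintype (Ω i)]

/-- Product weights have total mass one if each factor does. -/
lemma sum_prod_weight_eq_one {w : ∀ i, Ω i → ℝ} (hw : ∀ i, ∑ x, w i x = 1) :
    ∑ ω : ∀ i, Ω i, ∏ i, w i (ω i) = 1 := by
  rw [← Fintype.piFinset_univ, ← Finset.prod_univ_sum]
  simp [hw]

/-- Expectation of a function of one coordinate under product weights. -/
lemma sum_prod_weight_mul_coord {w : ∀ i, Ω i → ℝ} (hw : ∀ i, ∑ x, w i x = 1)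
    (f : ∀ i, Ω i → ℝ) (i : ι) :
    ∑ ω : ∀ i, Ω i, (∏ l, w l (ω l)) * f i (ω i) = ∑ x, w i x * f i x := by
  have h : ∀ ω : ∀ i, Ω i, (∏ l, w l (ω l)) * f i (ω i)
      = ∏ l, w l (ω l) * (if l = i then f l (ω l) else 1) := fun ω => by
    rw [Finset.prod_mul_distrib, Finset.prod_ite_eq' Finset.univ i (fun l => f l (ω l))]
    simp
  simp_rw [h]
  rw [← Fintype.piFinset_univ,
    ← Finset.prod_univ_sum (fun _ => Finset.univ)
      (fun l x => w l x * (if l = i then f l x else 1))]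
  rw [Finset.prod_eq_single i]
  · simp
  · intro l _ hl
    simp [hl, hw]
  · simp

/-- Distinct coordinates are uncorrelated under product weights. -/
lemma sum_prod_weight_mul_coord_mul_coord {w : ∀ i, Ω i → ℝ}
    {f : ∀ i, Ω i → ℝ} {i j : ι} (hij : i ≠ j) (hf : ∑ x, w i x * f i x = 0) :
    ∑ ω : ∀ i, Ω i, (∏ l, w l (ω l)) * (f i (ω i) * f j (ω j)) = 0 := by
  have h : ∀ ω : ∀ i, Ω i, (∏ l, w l (ω l)) * (f i (ω i) * f j (ω j))
      = ∏ l, w l (ω l) * ((if l = i then f l (ω l) else 1) * (if l = j then f l (ω l) else 1)) :=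
    fun ω => by
      rw [Finset.prod_mul_distrib, Finset.prod_mul_distrib,
        Finset.prod_ite_eq' Finset.univ i (fun l => f l (ω l)),
        Finset.prod_ite_eq' Finset.univ j (fun l => f l (ω l))]
      simp
  simp_rw [h]
  rw [← Fintype.piFinset_univ,
    ← Finset.prod_univ_sum (fun _ => Finset.univ)
      (fun l x => w l x * ((if l = i then f l x else 1) * (if l = j then f l x else 1)))]
  apply Finset.prod_eq_zero (Finset.mem_univ i)
  simpa [hij] using hf

/-- The variance of a sum of centred independent variables is the sum of the variances. -/
lemma sum_prod_weight_mul_sum_sq {w : ∀ i, Ω i → ℝ} (hw : ∀ i, ∑ x, w i x = 1)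
    {f : ∀ i, Ω i → ℝ} (hf : ∀ i, ∑ x, w i x * f i x = 0) :
    ∑ ω : ∀ i, Ω i, (∏ l, w l (ω l)) * (∑ i, f i (ω i)) ^ 2
      = ∑ i, ∑ x, w i x * f i x ^ 2 := by
  simp_rw [sq, Finset.sum_mul_sum, Finset.mul_sum]
  rw [Finset.sum_comm]
  refine Finset.sum_congr rfl fun i _ => ?_
  rw [Finset.sum_comm, Finset.sum_eq_single i]
  · exact sum_prod_weight_mul_coord hw (fun l x => f l x * f l x) i
  · intro j _ hj
    exact sum_prod_weight_mul_coord_mul_coord hj.symm (hf i)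
  · simp

/-- The variance of a sum of centred independent variables, for `r` copies of each factor. -/
lemma sum_prod_prod_weight_mul_sum_sq (r : ℕ) {w : ∀ i, Ω i → ℝ} (hw : ∀ i, ∑ x, w i x = 1)
    {f : ∀ i, Ω i → ℝ} (hf : ∀ i, ∑ x, w i x * f i x = 0) :
    ∑ ω : ∀ i, Fin r → Ω i, (∏ i, ∏ j, w i (ω i j)) * (∑ i, ∑ j, f i (ω i j)) ^ 2
      = r * ∑ i, ∑ x, w i x * f i x ^ 2 := by
  classical
  rw [sum_prod_weight_mul_sum_sq (Ω := fun i => Fin r → Ω i)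
    (w := fun i y => ∏ j, w i (y j)) (f := fun i y => ∑ j, f i (y j))
    (fun i => sum_prod_weight_eq_one fun _ => hw i)]
  · rw [Finset.mul_sum]
    refine Finset.sum_congr rfl fun i _ => ?_
    rw [sum_prod_weight_mul_sum_sq (Ω := fun _ : Fin r => Ω i)
      (w := fun _ => w i) (f := fun _ => f i) (fun _ => hw i) (fun _ => hf i)]
    simp
  · intro i
    simp_rw [Finset.mul_sum]
    rw [Finset.sum_comm]
    refine Finset.sum_eq_zero fun j _ => ?_
    rw [sum_prod_weight_mul_coord (Ω := fun _ : Fin r => Ω i)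
      (w := fun _ => w i) (fun _ => hw i) (fun _ => f i) j]
    exact hf i

/-- The mean squared Frobenius norm of a sum of centred independent random matrices. -/
lemma sum_prod_prod_weight_mul_frobSq {q : ℕ} (r : ℕ) {w : ∀ i, Ω i → ℝ}
    (hw : ∀ i, ∑ x, w i x = 1) {F : ∀ i, Ω i → Matrix (Fin q) (Fin q) ℂ}
    (hF : ∀ i, ∑ x, (w i x : ℂ) • F i x = 0) :
    ∑ ω : ∀ i, Fin r → Ω i, (∏ i, ∏ j, w i (ω i j)) * frobSq (∑ i, ∑ j, F i (ω i j))
      = r * ∑ i, ∑ x, w i x * frobSq (F i x) := by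
  have hent : ∀ i a b, ∑ x, (w i x : ℂ) * F i x a b = 0 := fun i a b => by
    simpa [Matrix.sum_apply] using congrFun (congrFun (hF i) a) b
  have hre : ∀ a b i, ∑ x, w i x * (F i x a b).re = 0 := fun a b i => by
    simpa using congrArg Complex.re (hent i a b)
  have him : ∀ a b i, ∑ x, w i x * (F i x a b).im = 0 := fun a b i => by
    simpa using congrArg Complex.im (hent i a b)
  have key : ∀ a b,
      ∑ ω : ∀ i, Fin r → Ω i, (∏ i, ∏ j, w i (ω i j)) *
          Complex.normSq ((∑ i, ∑ j, F i (ω i j)) a b)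
        = r * ∑ i, ∑ x, w i x * Complex.normSq (F i x a b) := fun a b => by
    have h1 := sum_prod_prod_weight_mul_sum_sq r hw (hre a b)
    have h2 := sum_prod_prod_weight_mul_sum_sq r hw (him a b)
    simp only [Complex.normSq_apply, Matrix.sum_apply, Complex.re_sum, Complex.im_sum, ← sq,
      mul_add, Finset.sum_add_distrib] at h1 h2 ⊢
    rw [h1, h2]
  simp only [frobSq, Finset.mul_sum] at key ⊢
  rw [Finset.sum_comm]
  calc _ = ∑ a, ∑ b, ∑ i, ∑ x, (r : ℝ) * (w i x * Complex.normSq (F i x a b)) := by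
        refine Finset.sum_congr rfl fun a _ => ?_
        rw [Finset.sum_comm]
        exact Finset.sum_congr rfl fun b _ => key a b
    _ = ∑ i, ∑ x, ∑ a, ∑ b, (r : ℝ) * (w i x * Complex.normSq (F i x a b)) := by
        have : ∀ a, ∑ b, ∑ i, ∑ x, (r : ℝ) * (w i x * Complex.normSq (F i x a b))
            = ∑ i, ∑ x, ∑ b, (r : ℝ) * (w i x * Complex.normSq (F i x a b)) := fun a => by
          rw [Finset.sum_comm]
          exact Finset.sum_congr rfl fun i _ => Finset.sum_comm
        simp_rw [this]
        rw [Finset.sum_comm]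
        exact Finset.sum_congr rfl fun i _ => Finset.sum_comm

end ProductWeights

section Frobenius

variable {q : ℕ}

lemma ofReal_frobSq {H : Matrix (Fin q) (Fin q) ℂ} (hH : H.IsHermitian) :
    (frobSq H : ℂ) = (H * H).trace := by
  simp only [frobSq, Matrix.trace, Matrix.diag_apply, Matrix.mul_apply, Complex.ofReal_sum]
  refine Finset.sum_congr rfl fun a _ => Finset.sum_congr rfl fun b _ => ?_
  rw [← Complex.mul_conj, ← hH.apply b a]
  rfl

lemma frobSq_nonneg (H : Matrix (Fin q) (Fin q) ℂ) : 0 ≤ frobSq H :=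
  Finset.sum_nonneg fun _ _ => Finset.sum_nonneg fun _ _ => Complex.normSq_nonneg _

lemma eq_zero_of_frobSq_eq_zero {H : Matrix (Fin q) (Fin q) ℂ} (h : frobSq H = 0) : H = 0 := by
  ext a b
  have h1 := (Finset.sum_eq_zero_iff_of_nonneg fun a _ =>
    Finset.sum_nonneg fun b _ => Complex.normSq_nonneg (H a b)).1 h a (Finset.mem_univ a)
  have h2 := (Finset.sum_eq_zero_iff_of_nonneg fun b _ =>
    Complex.normSq_nonneg (H a b)).1 h1 b (Finset.mem_univ b)
  simpa using h2

lemma frobSq_smul (c : ℂ) (H : Matrix (Fin q) (Fin q) ℂ) :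
    frobSq (c • H) = Complex.normSq c * frobSq H := by
  simp [frobSq, Finset.mul_sum]

/-- The trace of a product of two Hermitian matrices is real. -/
lemma ofReal_re_trace_mul {A B : Matrix (Fin q) (Fin q) ℂ} (hA : A.IsHermitian)
    (hB : B.IsHermitian) : (((A * B).trace.re : ℝ) : ℂ) = (A * B).trace := by
  apply Complex.conj_eq_iff_re.1
  have := Matrix.trace_conjTranspose (A * B)
  rw [Matrix.conjTranspose_mul, hA.eq, hB.eq, Matrix.trace_mul_comm] at this
  exact this.symm

/-- The trace of a Hermitian matrix is real. -/
lemma ofReal_re_trace {A : Matrix (Fin q) (Fin q) ℂ} (hA : A.IsHermitian) :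
    ((A.trace.re : ℝ) : ℂ) = A.trace := by
  simpa using ofReal_re_trace_mul hA Matrix.isHermitian_one

lemma isHermitian_smul_of_conj_eq {c : ℂ} (hc : star c = c) {A : Matrix (Fin q) (Fin q) ℂ}
    (hA : A.IsHermitian) : (c • A).IsHermitian := by
  rw [Matrix.IsHermitian, Matrix.conjTranspose_smul, hA.eq, hc]

end Frobenius

section Design

variable {q n : ℕ} {out : Fin n → ℕ} {P : (i : Fin n) → Fin (out i) → Matrix (Fin q) (Fin q) ℂ}

lemma trace_gramOf_mul (hn : n ≠ 0) (S X : Matrix (Fin q) (Fin q) ℂ) :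
    (n : ℂ) * (gramOf out P S * X).trace
      = ∑ i, ∑ k, (S * P i k).trace * (X * P i k).trace / (P i k).trace := by
  have hn' : (n : ℂ) ≠ 0 := Nat.cast_ne_zero.2 hn
  rw [gramOf, Matrix.smul_mul, Matrix.trace_smul, smul_eq_mul, mul_inv_cancel_left₀ hn']
  simp only [Finset.sum_mul, Matrix.trace_sum, Matrix.smul_mul, Matrix.trace_smul, smul_eq_mul]
  refine Finset.sum_congr rfl fun i _ => Finset.sum_congr rfl fun k _ => ?_
  rw [Matrix.trace_mul_comm X]
  ring

lemma sum_empFreq {r : ℕ} (hr : r ≠ 0) (ω : (i : Fin n) → Fin r → Fin (out i)) (i : Fin n) :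
    ∑ k, empFreq ω i k = 1 := by
  have hr' : (r : ℝ) ≠ 0 := Nat.cast_ne_zero.2 hr
  have h := Finset.card_eq_sum_card_fiberwise (s := Finset.univ) (t := Finset.univ) (f := ω i)
    (fun _ _ => Finset.mem_coe.2 (Finset.mem_univ _))
  simp only [empFreq, ← Finset.sum_div, ← Nat.cast_sum, ← h]
  simp [hr']

lemma sum_empFreq_smul {r : ℕ} (ω : (i : Fin n) → Fin r → Fin (out i)) (i : Fin n) :
    ∑ k, (empFreq ω i k : ℂ) • P i k = (r : ℂ)⁻¹ • ∑ j, P i (ω i j) := by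
  have h : ∀ k, (empFreq ω i k : ℂ) • P i k
      = (r : ℂ)⁻¹ • ∑ j, if ω i j = k then P i k else 0 := fun k => by
    rw [← Finset.sum_filter, Finset.sum_const, ← Nat.cast_smul_eq_nsmul ℂ, smul_smul]
    congr 1
    simp [empFreq, div_eq_inv_mul]
  simp_rw [h]
  rw [← Finset.smul_sum, Finset.sum_comm]
  simp

/-- The Gram form of an `α`-unitary design is `nα` times the Hilbert–Schmidt form. -/
lemma sum_trace_mul_trace_div {α : ℝ} (hn : n ≠ 0) {Δ : Matrix (Fin q) (Fin q) ℂ}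
    (hΔ : gramOf out P Δ = (α : ℂ) • Δ) (X : Matrix (Fin q) (Fin q) ℂ) :
    ∑ i, ∑ k, (Δ * P i k).trace * (X * P i k).trace / (P i k).trace
      = (n : ℂ) * α * (Δ * X).trace := by
  rw [← trace_gramOf_mul hn, hΔ, Matrix.smul_mul, Matrix.trace_smul, smul_eq_mul, mul_assoc]

lemma sum_re_trace_mul_re_trace_div {α : ℝ} (hn : n ≠ 0) (hherm : ∀ i k, (P i k).IsHermitian)
    {Δ X : Matrix (Fin q) (Fin q) ℂ} (hΔ : gramOf out P Δ = (α : ℂ) • Δ)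
    (hΔh : Δ.IsHermitian) (hX : X.IsHermitian) :
    ∑ i, ∑ k, (Δ * P i k).trace.re * (X * P i k).trace.re / (P i k).trace.re
      = n * α * (Δ * X).trace.re := by
  have h := sum_trace_mul_trace_div hn hΔ X
  apply Complex.ofReal_injective
  push_cast
  simp_rw [ofReal_re_trace_mul hΔh (hherm _ _), ofReal_re_trace_mul hX (hherm _ _),
    ofReal_re_trace (hherm _ _), ofReal_re_trace_mul hΔh hX]
  exact h

lemma isHermitian_lseOf (hherm : ∀ i k, (P i k).IsHermitian) (α : ℝ)
    (p : (i : Fin n) → Fin (out i) → ℝ) : (lseOf out P α p).IsHermitian := by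
  refine Matrix.IsHermitian.sub (isHermitian_smul_of_conj_eq (by simp) ?_)
    (isHermitian_smul_of_conj_eq (by simp) (isHermitian_smul_of_conj_eq (by simp)
      Matrix.isHermitian_one))
  refine isSelfAdjoint_sum _ fun i _ => isSelfAdjoint_sum _ fun k _ => ?_
  refine isHermitian_smul_of_conj_eq ?_ (hherm i k)
  rw [← ofReal_re_trace (hherm i k)]
  simp

lemma trace_lseOf {α : ℝ} (hα : α ≠ 0) (hn : n ≠ 0) (hq : q ≠ 0)
    (hm : ∀ i k, (P i k).trace ≠ 0) {p : (i : Fin n) → Fin (out i) → ℝ}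
    (hp : ∀ i, ∑ k, p i k = 1) : (lseOf out P α p).trace = 1 := by
  have hn' : (n : ℂ) ≠ 0 := Nat.cast_ne_zero.2 hn
  have hq' : (q : ℂ) ≠ 0 := Nat.cast_ne_zero.2 hq
  have hα' : (α : ℂ) ≠ 0 := Complex.ofReal_ne_zero.2 hα
  have hp' : ∀ i, ∑ k, (p i k : ℂ) = 1 := fun i => by exact_mod_cast hp i
  simp only [lseOf, Matrix.trace_sub, Matrix.trace_smul, Matrix.trace_sum, smul_eq_mul,
    div_mul_cancel₀ _ (hm _ _), hp', Matrix.trace_one, Finset.sum_const, Finset.card_univ,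
    Fintype.card_fin, nsmul_eq_mul]
  field_simp
  ring

lemma sum_div_smul_eq_lseOf {α : ℝ} (hα : α ≠ 0) (hn : n ≠ 0)
    (p : (i : Fin n) → Fin (out i) → ℝ) :
    ∑ i, ∑ k, ((p i k : ℂ) / (P i k).trace) • P i k
      = ((n : ℂ) * α) • (lseOf out P α p
          + (((1 : ℂ) - α) / α) • ((q : ℂ)⁻¹ • (1 : Matrix (Fin q) (Fin q) ℂ))) := by
  have hnα : (n : ℂ) * α ≠ 0 :=
    mul_ne_zero (Nat.cast_ne_zero.2 hn) (Complex.ofReal_ne_zero.2 hα)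
  rw [lseOf, sub_add_cancel, smul_inv_smul₀ hnα]

/-- The loss increases quadratically away from the least-squares estimator. -/
lemma lossOf_lseOf_add {α : ℝ} (hα : α ≠ 0) (hn : n ≠ 0) (hherm : ∀ i k, (P i k).IsHermitian)
    (p : (i : Fin n) → Fin (out i) → ℝ) {Δ : Matrix (Fin q) (Fin q) ℂ}
    (hΔ : gramOf out P Δ = (α : ℂ) • Δ) (hΔh : Δ.IsHermitian) (hΔ0 : Δ.trace = 0) :
    lossOf out P p (lseOf out P α p + Δ)
      = lossOf out P p (lseOf out P α p) + n * α * frobSq Δ := by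
  set L := lseOf out P α p with hL
  have hLh : L.IsHermitian := isHermitian_lseOf hherm α p
  have h1 := sum_re_trace_mul_re_trace_div hn hherm hΔ hΔh hLh
  have h2 := sum_re_trace_mul_re_trace_div hn hherm hΔ hΔh hΔh
  have h3 : ∑ i, ∑ k, (Δ * P i k).trace.re * p i k / (P i k).trace.re
      = n * α * (Δ * L).trace.re := by
    apply Complex.ofReal_injective
    push_cast
    simp_rw [ofReal_re_trace_mul hΔh (hherm _ _), ofReal_re_trace (hherm _ _),
      ofReal_re_trace_mul hΔh hLh]
    have h := congrArg (fun M => (Δ * M).trace) (sum_div_smul_eq_lseOf (P := P) hα hn p)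
    simp only [Finset.mul_sum, Matrix.trace_sum, Matrix.mul_smul, Matrix.trace_smul, mul_add,
      smul_eq_mul, Matrix.trace_add, mul_one, hΔ0, mul_zero, add_zero, ← hL] at h
    rw [← h]
    exact Finset.sum_congr rfl fun i _ => Finset.sum_congr rfl fun k _ => by ring
  have h4 : frobSq Δ = (Δ * Δ).trace.re := by rw [← ofReal_frobSq hΔh, Complex.ofReal_re]
  have h5 : lossOf out P p (L + Δ) = lossOf out P p L
      + 2 * (∑ i, ∑ k, (Δ * P i k).trace.re * (L * P i k).trace.re / (P i k).trace.re
        - ∑ i, ∑ k, (Δ * P i k).trace.re * p i k / (P i k).trace.re)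
      + ∑ i, ∑ k, (Δ * P i k).trace.re * (Δ * P i k).trace.re / (P i k).trace.re := by
    simp only [lossOf, Finset.mul_sum, ← Finset.sum_add_distrib, ← Finset.sum_sub_distrib]
    refine Finset.sum_congr rfl fun i _ => Finset.sum_congr rfl fun k _ => ?_
    rw [add_mul, Matrix.trace_add, Complex.add_re]
    ring
  rw [h5, h1, h2, h3, h4]
  ring

/-- An `α`-unitary design acts on a trace-one state by depolarisation. -/
lemma gramOf_of_trace_eq_one {α : ℝ} (hn : n ≠ 0) (hq : q ≠ 0) (hsum : ∀ i, ∑ k, P i k = 1)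
    (hm : ∀ i k, (P i k).trace ≠ 0)
    (hunitary : ∀ Δ : Matrix (Fin q) (Fin q) ℂ, Δ.IsHermitian → Δ.trace = 0 →
        gramOf out P Δ = (α : ℂ) • Δ)
    {ρ : Matrix (Fin q) (Fin q) ℂ} (hρ : ρ.IsHermitian) (hρtr : ρ.trace = 1) :
    gramOf out P ρ
      = (α : ℂ) • ρ + ((1 : ℂ) - α) • ((q : ℂ)⁻¹ • (1 : Matrix (Fin q) (Fin q) ℂ)) := by
  have hn' : (n : ℂ) ≠ 0 := Nat.cast_ne_zero.2 hn
  have hq' : (q : ℂ) ≠ 0 := Nat.cast_ne_zero.2 hq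
  set J : Matrix (Fin q) (Fin q) ℂ := (q : ℂ)⁻¹ • 1 with hJ
  have hJh : J.IsHermitian := isHermitian_smul_of_conj_eq (by simp) Matrix.isHermitian_one
  have hJtr : J.trace = 1 := by simp [hJ, hq']
  have hGJ : gramOf out P J = J := by
    simp only [gramOf, hJ, Matrix.smul_mul, one_mul, Matrix.trace_smul, smul_eq_mul,
      mul_div_assoc, div_self (hm _ _), mul_one, ← Finset.smul_sum, hsum, Finset.sum_const,
      Finset.card_univ, Fintype.card_fin]
    rw [← Nat.cast_smul_eq_nsmul ℂ, smul_comm _ (n : ℂ), inv_smul_smul₀ hn']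
  have hadd : gramOf out P ρ = gramOf out P (ρ - J) + gramOf out P J := by
    simp only [gramOf, ← smul_add, ← Finset.sum_add_distrib, ← add_smul, ← add_div,
      ← Matrix.trace_add, ← add_mul, sub_add_cancel]
  rw [hadd, hGJ, hunitary _ (hρ.sub hJh) (by rw [Matrix.trace_sub, hρtr, hJtr, sub_self])]
  module

/-- The estimation error is a normalised sum of centred independent matrices. -/
lemma lseOf_empFreq_sub {α : ℝ} {r : ℕ} (hα : α ≠ 0) (hn : n ≠ 0) (hr : r ≠ 0)
    (hone : ∀ i k, (P i k).trace = 1) {ρ : Matrix (Fin q) (Fin q) ℂ}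
    (hG : gramOf out P ρ
      = (α : ℂ) • ρ + ((1 : ℂ) - α) • ((q : ℂ)⁻¹ • (1 : Matrix (Fin q) (Fin q) ℂ)))
    (ω : (i : Fin n) → Fin r → Fin (out i)) :
    lseOf out P α (empFreq ω) - ρ = ((n : ℂ) * α * r)⁻¹ •
      ∑ i, ∑ j, (P i (ω i j) - ∑ k, (ρ * P i k).trace • P i k) := by
  have hn' : (n : ℂ) ≠ 0 := Nat.cast_ne_zero.2 hn
  have hr' : (r : ℂ) ≠ 0 := Nat.cast_ne_zero.2 hr
  have hα' : (α : ℂ) ≠ 0 := Complex.ofReal_ne_zero.2 hα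
  have hμ : ∑ i, ∑ k, (ρ * P i k).trace • P i k = (n : ℂ) • gramOf out P ρ := by
    simp only [gramOf, hone, div_one, smul_inv_smul₀ hn']
  simp only [Finset.sum_sub_distrib, Finset.sum_const, Finset.card_univ, Fintype.card_fin,
    ← Finset.smul_sum, hμ, hG, lseOf, hone, div_one, sum_empFreq_smul,
    ← Nat.cast_smul_eq_nsmul ℂ]
  match_scalars <;> field_simp

/-- The conditional variance of one shot of a rank-one observable. -/
lemma sum_mul_frobSq_sub (hherm : ∀ i k, (P i k).IsHermitian)
    (hproj : ∀ i k, P i k * P i k = P i k)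
    (horth : ∀ i (k k' : Fin (out i)), k ≠ k' → P i k * P i k' = 0)
    (hone : ∀ i k, (P i k).trace = 1) {ρ : Matrix (Fin q) (Fin q) ℂ} (hρ : ρ.IsHermitian)
    (i : Fin n) (hw : ∑ k, (ρ * P i k).trace.re = 1) :
    ∑ k, (ρ * P i k).trace.re * frobSq (P i k - ∑ l, (ρ * P i l).trace • P i l)
      = 1 - ∑ k, (ρ * P i k).trace.re * (ρ * P i k).trace.re := by
  set t : Fin (out i) → ℝ := fun k => (ρ * P i k).trace.re with ht
  have htc : ∀ k, (ρ * P i k).trace = (t k : ℂ) := fun k =>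
    (ofReal_re_trace_mul hρ (hherm i k)).symm
  set μ : Matrix (Fin q) (Fin q) ℂ := ∑ l, (ρ * P i l).trace • P i l with hμ
  have hμh : μ.IsHermitian := isSelfAdjoint_sum _ fun k _ =>
    isHermitian_smul_of_conj_eq (by rw [htc]; simp) (hherm i k)
  have hPP : ∀ k l, (P i k * P i l).trace = if k = l then 1 else 0 := fun k l => by
    split_ifs with h
    · rw [← h, hproj, hone]
    · rw [horth i k l h, Matrix.trace_zero]
  have hPμ : ∀ k, (P i k * μ).trace = t k := fun k => by
    simp [hμ, Finset.mul_sum, Matrix.trace_sum, hPP, htc]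
  have hμμ : (μ * μ).trace = ∑ k, (t k : ℂ) * t k := by
    conv_lhs => enter [1, 1]; rw [hμ]
    simp [Finset.sum_mul, Matrix.trace_sum, hPμ, htc]
  have hF : ∀ k, frobSq (P i k - μ) = 1 - 2 * t k + ∑ l, t l * t l := fun k => by
    apply Complex.ofReal_injective
    rw [ofReal_frobSq ((hherm i k).sub hμh), mul_sub, sub_mul, sub_mul, Matrix.trace_sub,
      Matrix.trace_sub, Matrix.trace_sub, Matrix.trace_mul_comm μ, hPμ, hμμ, hproj, hone]
    push_cast
    ring
  change ∑ k, t k * frobSq (P i k - μ) = 1 - ∑ k, t k * t k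
  have hw' : ∑ k, t k = 1 := hw
  calc ∑ k, t k * frobSq (P i k - μ)
      = ∑ k, (t k - 2 * (t k * t k) + t k * ∑ l, t l * t l) :=
        Finset.sum_congr rfl fun k _ => by rw [hF]; ring
    _ = 1 - ∑ k, t k * t k := by
        rw [Finset.sum_add_distrib, Finset.sum_sub_distrib, ← Finset.mul_sum, ← Finset.sum_mul,
          hw']
        ring

end Design

/-- For an `α`-unitary design (`α > 0`): the closed-form matrix `lseOf`
built from the empirical frequencies is the unique minimizer of the least-squares loss over
trace-one Hermitian matrices; and if every projection has rank one, the mean-squared error is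
`E‖ρ̂ − ρ‖₂² = (1/(nrα²))[(1 − 1/q) − α(tr(ρ²) − 1/q)]`. -/
theorem lse_formula_and_mse
    (q n r : ℕ) (hq : 2 ≤ q) (hn : 1 ≤ n) (hr : 1 ≤ r)
    (out : Fin n → ℕ) (hout : ∀ i, 2 ≤ out i)
    (P : (i : Fin n) → Fin (out i) → Matrix (Fin q) (Fin q) ℂ)
    (hherm : ∀ i k, (P i k).IsHermitian)
    (hproj : ∀ i k, P i k * P i k = P i k)
    (horth : ∀ i (k k' : Fin (out i)), k ≠ k' → P i k * P i k' = 0)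
    (hsum : ∀ i, ∑ k, P i k = 1)
    (hP0 : ∀ i k, P i k ≠ 0)
    (α : ℝ) (hα : 0 < α)
    (hunitary : ∀ Δ : Matrix (Fin q) (Fin q) ℂ, Δ.IsHermitian → Δ.trace = 0 →
        gramOf out P Δ = (α : ℂ) • Δ)
    (ρ : Matrix (Fin q) (Fin q) ℂ) (hρ : ρ.PosSemidef) (hρtr : ρ.trace = 1) :
    (∀ ω : (i : Fin n) → Fin r → Fin (out i),
      (lseOf out P α (empFreq ω)).IsHermitian ∧
      (lseOf out P α (empFreq ω)).trace = 1 ∧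
      (∀ T : Matrix (Fin q) (Fin q) ℂ, T.IsHermitian → T.trace = 1 →
        lossOf out P (empFreq ω) (lseOf out P α (empFreq ω)) ≤ lossOf out P (empFreq ω) T) ∧
      (∀ S : Matrix (Fin q) (Fin q) ℂ, S.IsHermitian → S.trace = 1 →
        (∀ T : Matrix (Fin q) (Fin q) ℂ, T.IsHermitian → T.trace = 1 →
          lossOf out P (empFreq ω) S ≤ lossOf out P (empFreq ω) T) →
        S = lseOf out P α (empFreq ω)))
    ∧
    ((∀ i k, (P i k).trace = 1) →
      ∑ ω : (i : Fin n) → Fin r → Fin (out i),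
          bornProb P ρ ω * frobSq (lseOf out P α (empFreq ω) - ρ)
        = (1 / ((n : ℝ) * r * α ^ 2)) *
            ((1 - 1 / q) - α * (((ρ * ρ).trace).re - 1 / q))) := by
  have hn0 : n ≠ 0 := by omega
  have hq0 : q ≠ 0 := by omega
  have hr0 : r ≠ 0 := by omega
  have hα0 : α ≠ 0 := hα.ne'
  have hm : ∀ i k, (P i k).trace ≠ 0 := fun i k h => by
    refine hP0 i k (eq_zero_of_frobSq_eq_zero (Complex.ofReal_injective ?_))
    rw [ofReal_frobSq (hherm i k), hproj, h, Complex.ofReal_zero]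
  have hnα : 0 < (n : ℝ) * α := mul_pos (Nat.cast_pos.2 hn) hα
  constructor
  · intro ω
    have hLh := isHermitian_lseOf hherm α (empFreq ω)
    have hLtr := trace_lseOf hα0 hn0 hq0 hm (sum_empFreq hr0 ω)
    have hloss : ∀ T : Matrix (Fin q) (Fin q) ℂ, T.IsHermitian → T.trace = 1 →
        lossOf out P (empFreq ω) T = lossOf out P (empFreq ω) (lseOf out P α (empFreq ω))
          + n * α * frobSq (T - lseOf out P α (empFreq ω)) := fun T hT hTtr => by
      have h0 : (T - lseOf out P α (empFreq ω)).trace = 0 := by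
        rw [Matrix.trace_sub, hTtr, hLtr, sub_self]
      have h := lossOf_lseOf_add hα0 hn0 hherm (empFreq ω)
        (hunitary _ (hT.sub hLh) h0) (hT.sub hLh) h0
      rwa [add_sub_cancel] at h
    refine ⟨hLh, hLtr, fun T hT hTtr => ?_, fun S hS hStr hmin => ?_⟩
    · rw [hloss T hT hTtr]
      exact le_add_of_nonneg_right (mul_nonneg hnα.le (frobSq_nonneg _))
    · have h := hmin _ hLh hLtr
      rw [hloss S hS hStr] at h
      have h0 : frobSq (S - lseOf out P α (empFreq ω)) = 0 :=
        le_antisymm (by nlinarith) (frobSq_nonneg _)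
      exact sub_eq_zero.1 (eq_zero_of_frobSq_eq_zero h0)
  · intro hone
    have hρh := hρ.isHermitian
    have hG := gramOf_of_trace_eq_one hn0 hq0 hsum hm hunitary hρh hρtr
    have htc : ∀ i k, (((ρ * P i k).trace.re : ℝ) : ℂ) = (ρ * P i k).trace := fun i k =>
      ofReal_re_trace_mul hρh (hherm i k)
    have hwc : ∀ i, ∑ k, (ρ * P i k).trace = 1 := fun i => by
      rw [← Matrix.trace_sum, ← Finset.mul_sum, hsum, mul_one, hρtr]
    have hw : ∀ i, ∑ k, (ρ * P i k).trace.re = 1 := fun i => by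
      rw [← Complex.re_sum, hwc, Complex.one_re]
    have hF : ∀ i, ∑ k, (((ρ * P i k).trace.re : ℝ) : ℂ) •
        (P i k - ∑ l, (ρ * P i l).trace • P i l) = 0 := fun i => by
      simp only [htc, smul_sub, Finset.sum_sub_distrib, ← Finset.sum_smul, hwc, one_smul, sub_self]
    have hpur : ∑ i, ∑ k, (ρ * P i k).trace.re * (ρ * P i k).trace.re
        = n * (α * (ρ * ρ).trace.re + (1 - α) / q) := by
      apply Complex.ofReal_injective
      have h := trace_gramOf_mul (out := out) (P := P) hn0 ρ ρ
      simp only [hone, div_one, hG, add_mul, Matrix.smul_mul, one_mul, Matrix.trace_add,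
        Matrix.trace_smul, hρtr, smul_eq_mul, mul_one] at h
      push_cast
      simp_rw [htc, ofReal_re_trace_mul hρh hρh, ← h]
      ring
    have hn' : (n : ℝ) ≠ 0 := Nat.cast_ne_zero.2 hn0
    have hr' : (r : ℝ) ≠ 0 := Nat.cast_ne_zero.2 hr0
    have hq' : (q : ℝ) ≠ 0 := Nat.cast_ne_zero.2 hq0
    simp_rw [lseOf_empFreq_sub hα0 hn0 hr0 hone hG, frobSq_smul, bornProb,
      mul_left_comm _ (Complex.normSq _) _]
    rw [← Finset.mul_sum, sum_prod_prod_weight_mul_frobSq r hw hF]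
    simp only [sum_mul_frobSq_sub hherm hproj horth hone hρh _ (hw _), Finset.sum_sub_distrib,
      Finset.sum_const, Finset.card_univ, Fintype.card_fin, nsmul_eq_mul, mul_one, hpur,
      map_inv₀, map_mul, Complex.normSq_natCast, Complex.normSq_ofReal]
    field_simp
    ring
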